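/- Optimality of step allocations (Theorem B.3): Let F be a distribution on [0, h̄] with twice continuously differentiable density f > 0 such that d/dv (R''(v)/f(v)) ≤ 0, where R(v) := v·(1 − F(v)), and let g : [0, h̄] × ℝ → ℝ be a twice continuously differentiable tradeoff function with ∂²g/∂u² ≤ 0 and ∂²g/∂v∂u ≤ 0. Then in the type-dependent revenue-utility-tradeoff problem, the supremum of the objective over all IC mechanisms equals the supremum over IC mechanisms whose allocation is an (α, ν)-step allocation, i.e., x(v) = α for v ≤ ν and x(v) = 1 for v > ν, for some α ∈ [0,1] and ν ∈ [0, h̄]. In particular, if an optimal mechanism exists, there is an optimal mechanism whose allocation is an (α, ν)-step allocation. -/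

import Mathlib

/-!
Theorem B.3 (optimality of step allocations): for a distribution on `[0, h̄]`
with twice continuously differentiable positive density `f` such that
`(R''/f)' ≤ 0` (where `R(v) = v (1 - F(v))`), and a twice continuously
differentiable tradeoff function `g` with `∂²g/∂u² ≤ 0` and `∂²g/∂v∂u ≤ 0`,
the supremum of `E[p(v) + g(v, v x(v) - p(v))]` over IC mechanisms equals the
supremum over IC mechanisms whose allocation is an `(α, ν)`-step allocation;
in particular, if an optimal mechanism exists, an optimal step mechanism
exists.
-/

open MeasureTheory

namespace Stmt17

/-- CDF of the distribution with density `f` on `[0, h̄]`. -/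
noncomputable def cdf (f : ℝ → ℝ) (v : ℝ) : ℝ :=
  ∫ t in Set.Icc 0 v, f t

/-- The revenue function `R(v) = v (1 - F(v))`. -/
noncomputable def revFn (f : ℝ → ℝ) (v : ℝ) : ℝ :=
  v * (1 - cdf f v)

/-- Objective of the type-dependent revenue-utility tradeoff problem. -/
noncomputable def tObj (μ : Measure ℝ) (g : ℝ → ℝ → ℝ) (x p : ℝ → ℝ) : ℝ :=
  ∫ v, (p v + g v (v * x v - p v)) ∂μ

/-- Feasibility: allocation probabilities and IC on the support. -/
def Feas (hb : ℝ) (x p : ℝ → ℝ) : Prop :=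
  (∀ v, x v ∈ Set.Icc (0 : ℝ) 1) ∧
  (∀ v ∈ Set.Icc 0 hb, ∀ v' ∈ Set.Icc 0 hb, v * x v' - p v' ≤ v * x v - p v)

/-- An `(α, ν)`-step allocation: `x(v) = α` for `v ≤ ν` and `x(v) = 1`
otherwise. -/
def IsStep (hb : ℝ) (x : ℝ → ℝ) : Prop :=
  ∃ α ν : ℝ, α ∈ Set.Icc (0 : ℝ) 1 ∧ ν ∈ Set.Icc 0 hb ∧
    ∀ v, x v = if v ≤ ν then α else 1

end Stmt17

namespace Stmt17

/-- Virtual-value derivative term is antitone. -/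
lemma phi_antitone (hb : ℝ) (f : ℝ → ℝ) (hsmooth : ContDiff ℝ 2 f)
    (hpos : ∀ v ∈ Set.Icc 0 hb, 0 < f v)
    (hdens : ∀ v ∈ Set.Icc 0 hb, deriv (fun w => deriv (deriv (revFn f)) w / f w) v ≤ 0) :
    AntitoneOn (fun v => (-2 * f v - v * deriv f v) / f v) (Set.Icc 0 hb) := by
  have hf : Differentiable ℝ f := hsmooth.differentiable (by norm_num)
  have hf1 : ContDiff ℝ 1 (deriv f) := by
    have h : ContDiff ℝ (1 + 1) f := by
      rw [one_add_one_eq_two]; exact hsmooth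
    exact (contDiff_succ_iff_deriv.1 h).2.2
  have hfd : Differentiable ℝ (deriv f) := hf1.differentiable (by norm_num)
  have hF : ∀ w : ℝ, 0 < w → HasDerivAt (cdf f) (f w) w := by
    intro w hw
    have h1 : HasDerivAt (fun u => ∫ t in (0:ℝ)..u, f t) (f w) w :=
      intervalIntegral.integral_hasDerivAt_right (hf.continuous.intervalIntegrable _ _)
        (hf.continuous.stronglyMeasurableAtFilter _ _) hf.continuous.continuousAt
    refine h1.congr_of_eventuallyEq ?_
    filter_upwards [lt_mem_nhds hw] with z hz
    rw [cdf, intervalIntegral.integral_of_le hz.le, integral_Icc_eq_integral_Ioc]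
  have hR : ∀ w : ℝ, 0 < w → HasDerivAt (revFn f) (1 - cdf f w - w * f w) w := by
    intro w hw
    have h := (hasDerivAt_id w).mul ((hF w hw).const_sub 1)
    refine h.congr_deriv ?_
    simp; ring
  have hR2 : ∀ w : ℝ, 0 < w → deriv (deriv (revFn f)) w = -2 * f w - w * deriv f w := by
    intro w hw
    have h : HasDerivAt (fun w => 1 - cdf f w - w * f w) (-2 * f w - w * deriv f w) w := by
      have h := ((hF w hw).const_sub 1).sub ((hasDerivAt_id w).mul (hf w).hasDerivAt)
      refine h.congr_deriv ?_
      simp; ring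
    have e : deriv (revFn f) =ᶠ[nhds w] (fun w => 1 - cdf f w - w * f w) := by
      filter_upwards [lt_mem_nhds hw] with z hz
      exact (hR z hz).deriv
    rw [e.deriv_eq, h.deriv]
  apply antitoneOn_of_deriv_nonpos (convex_Icc 0 hb)
  · apply ContinuousOn.div
    · exact ((continuous_const.mul hf.continuous).sub
        (continuous_id.mul hfd.continuous)).continuousOn
    · exact hf.continuous.continuousOn
    · intro v hv; exact (hpos v hv).ne'
  · intro v hv
    have hv' := interior_subset hv
    apply DifferentiableAt.differentiableWithinAt
    exact (((hf v).const_mul (-2)).sub (differentiableAt_id.mul (hfd v))).div (hf v) (hpos v hv').ne'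
  · intro v hv
    have hv' := interior_subset hv
    rw [interior_Icc] at hv
    have e : (fun w => deriv (deriv (revFn f)) w / f w) =ᶠ[nhds v]
        (fun v => (-2 * f v - v * deriv f v) / f v) := by
      filter_upwards [lt_mem_nhds hv.1] with z hz
      rw [hR2 z hz]
    rw [← e.deriv_eq]
    exact hdens v hv'

/-- The partial derivative of `g` in `u` is jointly `C¹`. -/
lemma gu_contDiff (g : ℝ → ℝ → ℝ)
    (hg : ContDiff ℝ 2 (fun q : ℝ × ℝ => g q.1 q.2)) :
    (∀ v, Differentiable ℝ (g v)) ∧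
      ContDiff ℝ 1 (fun q : ℝ × ℝ => deriv (g q.1) q.2) := by
  have hd : Differentiable ℝ (fun q : ℝ × ℝ => g q.1 q.2) := hg.differentiable (by norm_num)
  have key : ∀ v u, HasDerivAt (g v)
      (fderiv ℝ (fun q : ℝ × ℝ => g q.1 q.2) (v, u) (0, 1)) u := by
    intro v u
    have h1 : HasDerivAt (fun t : ℝ => (v, t)) ((0 : ℝ), (1 : ℝ)) u :=
      (hasDerivAt_const u v).prodMk (hasDerivAt_id u)
    exact ((hd (v, u)).hasFDerivAt).comp_hasDerivAt u h1
  refine ⟨fun v u => (key v u).differentiableAt, ?_⟩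
  have e : (fun q : ℝ × ℝ => deriv (g q.1) q.2) =
      fun q => fderiv ℝ (fun q : ℝ × ℝ => g q.1 q.2) q (0, 1) := by
    funext q
    exact (key q.1 q.2).deriv
  rw [e]
  exact (hg.fderiv_right (m := 1) (by norm_num)).clm_apply contDiff_const

lemma gu_antitone (hb : ℝ) (g : ℝ → ℝ → ℝ)
    (hg : ContDiff ℝ 2 (fun q : ℝ × ℝ => g q.1 q.2))
    (hguu : ∀ v ∈ Set.Icc 0 hb, ∀ u : ℝ, deriv (deriv (g v)) u ≤ 0)
    (hgvu : ∀ v ∈ Set.Icc 0 hb, ∀ u : ℝ, deriv (fun w => deriv (g w) u) v ≤ 0) :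
    (∀ v ∈ Set.Icc 0 hb, Antitone (deriv (g v))) ∧
    (∀ u, AntitoneOn (fun w => deriv (g w) u) (Set.Icc 0 hb)) := by
  have h := (gu_contDiff g hg).2
  constructor
  · intro v hv
    have h2 : ContDiff ℝ 1 (fun u => deriv (g v) u) :=
      h.comp (contDiff_const.prodMk contDiff_id)
    exact antitone_of_deriv_nonpos (h2.differentiable (by norm_num)) (hguu v hv)
  · intro u
    have h2 : ContDiff ℝ 1 (fun w => deriv (g w) u) :=
      h.comp (contDiff_id.prodMk contDiff_const)
    exact antitoneOn_of_deriv_nonpos (convex_Icc 0 hb) h2.continuous.continuousOn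
      (h2.differentiable (by norm_num)).differentiableOn
      (fun v hv => hgvu v (interior_subset hv) u)

lemma g_concave (g : ℝ → ℝ → ℝ)
    (hg : ContDiff ℝ 2 (fun q : ℝ × ℝ => g q.1 q.2)) {v : ℝ}
    (hanti : Antitone (deriv (g v))) (a b : ℝ) :
    g v a ≤ g v b + deriv (g v) b * (a - b) := by
  have hd := (gu_contDiff g hg).1 v
  have hc : ConcaveOn ℝ Set.univ (g v) :=
    hanti.concaveOn_univ_of_deriv hd
  rcases lt_trichotomy a b with h | h | h
  · have := hc.le_slope_of_hasDerivAt (Set.mem_univ a) (Set.mem_univ b) h (hd b).hasDerivAt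
    rw [slope_def_field, le_div_iff₀ (by linarith)] at this
    linarith
  · subst h; simp
  · have := hc.slope_le_of_hasDerivAt (Set.mem_univ b) (Set.mem_univ a) h (hd b).hasDerivAt
    rw [slope_def_field, div_le_iff₀ (by linarith)] at this
    linarith

/-- The utility of a feasible mechanism. -/
noncomputable def util (x p : ℝ → ℝ) (v : ℝ) : ℝ := v * x v - p v

lemma util_sub {hb : ℝ} {x p : ℝ → ℝ} (h : Feas hb x p) {a b : ℝ}
    (ha : a ∈ Set.Icc 0 hb) (hb' : b ∈ Set.Icc 0 hb) :
    util x p a + x a * (b - a) ≤ util x p b := by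
  have := h.2 b hb' a ha
  unfold util
  linarith

lemma x_mono {hb : ℝ} {x p : ℝ → ℝ} (h : Feas hb x p) : MonotoneOn x (Set.Icc 0 hb) := by
  intro a ha b hb' hab
  have h1 := util_sub h ha hb'
  have h2 := util_sub h hb' ha
  rcases hab.eq_or_lt with e | e
  · rw [e]
  · by_contra! hc
    nlinarith

lemma util_mono {hb : ℝ} {x p : ℝ → ℝ} (h : Feas hb x p) {a b : ℝ}
    (ha : a ∈ Set.Icc 0 hb) (hb' : b ∈ Set.Icc 0 hb) (hab : a ≤ b) :
    util x p a ≤ util x p b := by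
  have h1 := util_sub h ha hb'
  nlinarith [(h.1 a).1, mul_nonneg (h.1 a).1 (sub_nonneg.2 hab)]

lemma util_lip {hb : ℝ} {x p : ℝ → ℝ} (h : Feas hb x p) {a b : ℝ}
    (ha : a ∈ Set.Icc 0 hb) (hb' : b ∈ Set.Icc 0 hb) (hab : a ≤ b) :
    util x p b ≤ util x p a + (b - a) := by
  have h1 := util_sub h hb' ha
  nlinarith [mul_nonneg (sub_nonneg.2 (h.1 b).2) (sub_nonneg.2 hab)]

lemma util_cont {hb : ℝ} {x p : ℝ → ℝ} (h : Feas hb x p) :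
    ContinuousOn (util x p) (Set.Icc 0 hb) := by
  have : LipschitzOnWith 1 (util x p) (Set.Icc 0 hb) := by
    apply LipschitzOnWith.of_dist_le_mul
    intro a ha b hb'
    rw [Real.dist_eq, Real.dist_eq]
    simp only [NNReal.coe_one, one_mul]
    rcases le_total a b with hab | hab
    · have h1 := util_mono h ha hb' hab
      have h2 := util_lip h ha hb' hab
      rw [abs_of_nonpos (by linarith), abs_of_nonpos (by linarith)]
      linarith
    · have h1 := util_mono h hb' ha hab
      have h2 := util_lip h hb' ha hab
      rw [abs_of_nonneg (by linarith), abs_of_nonneg (by linarith)]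
      linarith
  exact this.continuousOn

lemma util_hasDeriv {hb : ℝ} {x p : ℝ → ℝ} (h : Feas hb x p) {v : ℝ}
    (hv : v ∈ Set.Ioo 0 hb) (hc : ContinuousWithinAt x (Set.Icc 0 hb) v) :
    HasDerivAt (util x p) (x v) v := by
  have hn : Set.Icc 0 hb ∈ nhds v := Icc_mem_nhds hv.1 hv.2
  have hca : ContinuousAt x v := hc.continuousAt hn
  apply HasDerivAt.of_isLittleO
  rw [Asymptotics.isLittleO_iff]
  intro c hc0
  filter_upwards [hn, Metric.continuousAt_iff'.1 hca c hc0] with w hw hwc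
  have hv' : v ∈ Set.Icc 0 hb := ⟨hv.1.le, hv.2.le⟩
  have h1 := util_sub h hv' hw
  have h2 := util_sub h hw hv'
  rw [Real.dist_eq] at hwc
  rw [Real.norm_eq_abs, Real.norm_eq_abs, smul_eq_mul, abs_of_nonneg (by linarith)]
  have h3 : util x p w - util x p v - (w - v) * x v ≤ (x w - x v) * (w - v) := by linarith
  refine h3.trans ((le_abs_self _).trans ?_)
  rw [abs_mul]
  exact mul_le_mul_of_nonneg_right hwc.le (abs_nonneg _)

lemma tObj_eq {hb : ℝ} (hhb : 0 ≤ hb) {f : ℝ → ℝ} (hsmooth : ContDiff ℝ 2 f)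
    (hpos : ∀ v ∈ Set.Icc 0 hb, 0 < f v) {μ : Measure ℝ}
    (hμ : μ = (MeasureTheory.volume.restrict (Set.Icc 0 hb)).withDensity
        (fun v => ENNReal.ofReal (f v))) {g : ℝ → ℝ → ℝ}
    (hg : ContDiff ℝ 2 (fun q : ℝ × ℝ => g q.1 q.2))
    {x p : ℝ → ℝ} (h : Feas hb x p) :
    IntervalIntegrable (fun v => f v * g v (util x p v)
        + (-2 * f v - v * deriv f v) * util x p v) volume 0 hb ∧
    tObj μ g x p = hb * f hb * util x p hb +
      ∫ v in (0:ℝ)..hb, (f v * g v (util x p v)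
        + (-2 * f v - v * deriv f v) * util x p v) := by
  have hf : Differentiable ℝ f := hsmooth.differentiable (by norm_num)
  have hfc := hf.continuous
  have hfd : Continuous (deriv f) := hsmooth.continuous_deriv (by norm_num)
  have hu := util_cont h
  have hgc : ContinuousOn (fun v => g v (util x p v)) (Set.Icc 0 hb) :=
    hg.continuous.comp_continuousOn (continuousOn_id.prodMk hu)
  have hI : Set.uIcc 0 hb = Set.Icc 0 hb := Set.uIcc_of_le hhb
  have i1 : IntervalIntegrable (fun v => f v * g v (util x p v)
        + (-2 * f v - v * deriv f v) * util x p v) volume 0 hb := by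
    apply ContinuousOn.intervalIntegrable
    rw [hI]
    exact (hfc.continuousOn.mul hgc).add ((Continuous.continuousOn (by fun_prop)).mul hu)
  refine ⟨i1, ?_⟩
  have ix : IntervalIntegrable x volume 0 hb :=
    MonotoneOn.intervalIntegrable (by rw [hI]; exact x_mono h)
  have i2 : IntervalIntegrable (fun v => (f v + v * deriv f v) * util x p v
      + v * f v * x v) volume 0 hb := by
    apply IntervalIntegrable.add
    · apply ContinuousOn.intervalIntegrable
      rw [hI]
      exact (Continuous.continuousOn (by fun_prop)).mul hu
    · exact ix.continuousOn_mul (Continuous.continuousOn (by fun_prop))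
  have parts := integral_eq_of_hasDerivAt_off_countable
    (fun v => v * f v * util x p v)
    (fun v => (f v + v * deriv f v) * util x p v + v * f v * x v)
    (a := 0) (b := hb) (x_mono h).countable_not_continuousWithinAt
    (by rw [hI]; exact (Continuous.continuousOn (by fun_prop)).mul hu)
    (by
      rintro v ⟨hv, hvs⟩
      rw [min_eq_left hhb, max_eq_right hhb] at hv
      have hcx : ContinuousWithinAt x (Set.Icc 0 hb) v := by
        by_contra hcon
        exact hvs ⟨⟨hv.1.le, hv.2.le⟩, hcon⟩
      have h1 := ((hasDerivAt_id v).mul (hf v).hasDerivAt).mul (util_hasDeriv h hv hcx)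
      refine h1.congr_deriv ?_
      simp)
    i2
  have e1 : tObj μ g x p = ∫ v in (0:ℝ)..hb, f v * (p v + g v (v * x v - p v)) := by
    rw [tObj, hμ, integral_withDensity_eq_integral_toReal_smul
      (hfc.measurable.ennreal_ofReal) (by simp),
      intervalIntegral.integral_of_le hhb, ← integral_Icc_eq_integral_Ioc]
    apply setIntegral_congr_fun measurableSet_Icc
    intro v hv
    simp only [smul_eq_mul]
    rw [ENNReal.toReal_ofReal (hpos v hv).le]
  have e2 : (∫ v in (0:ℝ)..hb, f v * (p v + g v (v * x v - p v))) =
      ∫ v in (0:ℝ)..hb, (((f v + v * deriv f v) * util x p v + v * f v * x v) +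
        (f v * g v (util x p v) + (-2 * f v - v * deriv f v) * util x p v)) := by
    congr 1
    funext v
    unfold util
    ring
  rw [e1, e2, intervalIntegral.integral_add i2 i1, parts]
  simp

lemma exists_step {hb : ℝ} (hhb : 0 < hb) {f : ℝ → ℝ} (hsmooth : ContDiff ℝ 2 f)
    (hpos : ∀ v ∈ Set.Icc 0 hb, 0 < f v) {μ : Measure ℝ}
    (hμ : μ = (MeasureTheory.volume.restrict (Set.Icc 0 hb)).withDensity
        (fun v => ENNReal.ofReal (f v)))
    (hdens : ∀ v ∈ Set.Icc 0 hb, deriv (fun w => deriv (deriv (revFn f)) w / f w) v ≤ 0)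
    {g : ℝ → ℝ → ℝ}
    (hg : ContDiff ℝ 2 (fun q : ℝ × ℝ => g q.1 q.2))
    (hguu : ∀ v ∈ Set.Icc 0 hb, ∀ u : ℝ, deriv (deriv (g v)) u ≤ 0)
    (hgvu : ∀ v ∈ Set.Icc 0 hb, ∀ u : ℝ, deriv (fun w => deriv (g w) u) v ≤ 0)
    {x p : ℝ → ℝ} (h : Feas hb x p) :
    ∃ y q : ℝ → ℝ, Feas hb y q ∧ IsStep hb y ∧ tObj μ g x p ≤ tObj μ g y q := by
  have hf : Differentiable ℝ f := hsmooth.differentiable (by norm_num)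
  have hfc := hf.continuous
  have hfd : Continuous (deriv f) := hsmooth.continuous_deriv (by norm_num)
  have hphi := phi_antitone hb f hsmooth hpos hdens
  obtain ⟨ga, gb⟩ := gu_antitone hb g hg hguu hgvu
  have m0 : (0:ℝ) ∈ Set.Icc 0 hb := ⟨le_rfl, hhb.le⟩
  have mh : hb ∈ Set.Icc 0 hb := ⟨hhb.le, le_rfl⟩
  set u := util x p with hu_def
  set φ : ℝ → ℝ := fun v => (-2 * f v - v * deriv f v) / f v with hφ
  -- the marginal value, and its crossing point
  let K : ℝ → ℝ := fun v => deriv (g v) (u v) + φ v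
  have hKc : ContinuousOn K (Set.Icc 0 hb) := by
    apply ContinuousOn.add
    · exact (gu_contDiff g hg).2.continuous.comp_continuousOn
        (continuousOn_id.prodMk (util_cont h))
    · exact ContinuousOn.div (Continuous.continuousOn (by fun_prop)) hfc.continuousOn
        (fun v hv => (hpos v hv).ne')
  obtain ⟨s, hs, hs1, hs2⟩ : ∃ s ∈ Set.Icc 0 hb, (s = 0 ∨ 0 ≤ K s) ∧ (s = hb ∨ K s ≤ 0) := by
    by_cases c1 : K 0 ≤ 0
    · exact ⟨0, m0, Or.inl rfl, Or.inr c1⟩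
    by_cases c2 : 0 ≤ K hb
    · exact ⟨hb, mh, Or.inr c2, Or.inl rfl⟩
    push Not at c1 c2
    obtain ⟨s, hs, e⟩ := intermediate_value_Icc' hhb.le hKc ⟨c2.le, c1.le⟩
    exact ⟨s, hs, Or.inr e.ge, Or.inr e.le⟩
  -- the step mechanism
  set c := u 0 with hc
  set d := u hb - hb with hd
  set α := (u s - u 0) / s with hα
  have hαs : α * s = u s - c := by
    rcases hs.1.eq_or_lt with e | e
    · rw [← e]; simp [hc]
    · rw [hα, hc]; exact div_mul_cancel₀ _ e.ne'
  have hα0 : 0 ≤ α := div_nonneg (sub_nonneg.2 (util_mono h m0 hs hs.1)) hs.1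
  have hα1 : α ≤ 1 := by
    apply div_le_one_of_le₀ _ hs.1
    have := util_lip h m0 hs hs.1
    linarith
  have hdc : d ≤ c := by
    have := util_lip h m0 mh hhb.le
    linarith
  have chord_hi : ∀ v ∈ Set.Icc 0 hb, v ≤ s → u v ≤ c + α * v := by
    intro v hv hvs
    rcases hs.1.eq_or_lt with e | e
    · have : v = 0 := le_antisymm (by linarith) hv.1
      subst this
      simp [hc]
    · have h1 := util_sub h hv m0
      have h2 := util_sub h hv hs
      have h3 : s * u v ≤ s * (c + α * v) := by
        have : s * (c + α * v) = (s - v) * c + v * u s := by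
          have : s * (α * v) = v * (α * s) := by ring
          rw [mul_add, this, hαs]; ring
        rw [this]
        have t1 := mul_le_mul_of_nonneg_left h1 (sub_nonneg.2 hvs)
        have t2 := mul_le_mul_of_nonneg_left h2 hv.1
        simp only [← hu_def, ← hc] at t1 t2
        nlinarith
      exact le_of_mul_le_mul_left h3 e
  have chord_lo : ∀ v ∈ Set.Icc 0 hb, s ≤ v → c + α * v ≤ u v := by
    intro v hv hvs
    rcases hs.1.eq_or_lt with e | e
    · have : α = 0 := by rw [hα, ← e]; simp
      rw [this, zero_mul, add_zero]
      exact util_mono h m0 hv hv.1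
    · have h1 := util_sub h hs m0
      have h2 := util_sub h hs hv
      simp only [← hu_def, ← hc] at h1 h2
      have hαx : α ≤ x s := by
        apply le_of_mul_le_mul_right _ e
        linarith
      have := mul_le_mul_of_nonneg_right hαx (sub_nonneg.2 hvs)
      linarith
  have line1 : ∀ v ∈ Set.Icc 0 hb, d + v ≤ u v := by
    intro v hv
    have := util_lip h hv mh hv.2
    linarith
  let w : ℝ → ℝ := fun v => max (c + α * v) (d + v)
  have hw : ∀ v, w v = max (c + α * v) (d + v) := fun _ => rfl
  have hwmono : Monotone w := by
    intro a b hab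
    exact max_le_max (by nlinarith) (by linarith)
  have hwhb : w hb = u hb := by
    rw [hw, max_eq_right]
    · rw [hd]; ring
    · have := chord_lo hb mh hs.2
      linarith
  have hws : w s = u s := by
    rw [hw, hαs, max_eq_left] <;> linarith [line1 s hs]
  obtain ⟨ν, hν, hνe⟩ : ∃ ν ∈ Set.Icc 0 hb, (1 - α) * ν = c - d := by
    have hh := chord_lo hb mh hs.2
    rcases hα1.eq_or_lt with e | e
    · refine ⟨0, m0, ?_⟩
      rw [e] at hh ⊢
      linarith
    · have e' : 0 < 1 - α := by linarith
      refine ⟨(c - d) / (1 - α), ⟨div_nonneg (by linarith) e'.le, ?_⟩, by field_simp⟩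
      rw [div_le_iff₀ e']
      linarith
  let y : ℝ → ℝ := fun v => if v ≤ ν then α else 1
  let q : ℝ → ℝ := fun v => v * y v - w v
  have hyq : util y q = w := by
    funext v
    simp [util, q]
  have hwlo : ∀ v, v ≤ ν → w v = c + α * v := by
    intro v hv
    rw [hw, max_eq_left]
    nlinarith
  have hwhi : ∀ v, ν < v → w v = d + v := by
    intro v hv
    rw [hw, max_eq_right]
    nlinarith
  have hfeas : Feas hb y q := by
    constructor
    · intro v
      by_cases hv : v ≤ ν
      · simp [y, hv, hα0, hα1]
      · simp [y, hv]
    · intro v hv v' hv'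
      have e1 : v * y v - q v = w v := by simp [q]
      rw [e1]
      by_cases hc' : v' ≤ ν
      · have : v * y v' - q v' = c + α * v := by
          simp only [q, hwlo v' hc', y, hc', if_true]; ring
        rw [this]; exact le_max_left _ _
      · have : v * y v' - q v' = d + v := by
          simp only [q, hwhi v' (not_le.1 hc'), y, hc', if_false]; ring
        rw [this]; exact le_max_right _ _
  refine ⟨y, q, hfeas, ⟨α, ν, ⟨hα0, hα1⟩, hν, fun _ => rfl⟩, ?_⟩
  obtain ⟨i1, e1⟩ := tObj_eq hhb.le hsmooth hpos hμ hg h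
  obtain ⟨i2, e2⟩ := tObj_eq hhb.le hsmooth hpos hμ hg hfeas
  rw [hyq] at i2 e2
  rw [e1, e2, hwhb]
  apply add_le_add le_rfl
  apply intervalIntegral.integral_mono_on hhb.le i1 i2
  intro v hv
  simp only [← hu_def]
  have hfv := hpos v hv
  have hconc := g_concave g hg (ga v hv) (u v) (w v)
  have hφf : -2 * f v - v * deriv f v = φ v * f v := by
    simp only [hφ]; field_simp
  have hH : ∀ a ∈ Set.Icc 0 hb, ∀ b ∈ Set.Icc 0 hb, a ≤ b →
      deriv (g b) (w b) + φ b ≤ deriv (g a) (w a) + φ a := by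
    intro a ha b hb' hab
    have t1 := hphi ha hb' hab
    have t2 := gb (w b) ha hb' hab
    have t3 := ga a ha (hwmono hab)
    simp only at t1 t2
    linarith
  have hKs : deriv (g s) (w s) + φ s = K s := by rw [hws]
  have hprod : 0 ≤ (deriv (g v) (w v) + φ v) * (w v - u v) := by
    rcases le_total v s with hvs | hvs
    · have hge : u v ≤ w v := (chord_hi v hv hvs).trans (le_max_left _ _)
      rcases hs1 with e | e
      · have : v = s := le_antisymm hvs (by rw [e]; exact hv.1)
        rw [this, hws]; simp
      · have := hH v hv s hs hvs
        exact mul_nonneg (by linarith) (by linarith)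
    · have hle : w v ≤ u v := max_le (chord_lo v hv hvs) (line1 v hv)
      rcases hs2 with e | e
      · have : v = s := le_antisymm (by rw [e]; exact hv.2) hvs
        rw [this, hws]; simp
      · have := hH s hs v hv hvs
        exact mul_nonneg_of_nonpos_of_nonpos (by linarith) (by linarith)
  rw [hφf]
  have key : 0 ≤ f v * ((g v (w v) + φ v * w v) - (g v (u v) + φ v * u v)) := by
    apply mul_nonneg hfv.le
    nlinarith
  linarith

end Stmt17

open Stmt17 in
/-- **Theorem B.3** (optimality of `(α, ν)`-step allocations). -/
theorem stmt_17 (hb : ℝ) (hhb : 0 ≤ hb)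
    (f : ℝ → ℝ) (hsmooth : ContDiff ℝ 2 f)
    (hpos : ∀ v ∈ Set.Icc 0 hb, 0 < f v)
    (hone : (∫ v in Set.Icc 0 hb, f v) = 1)
    (μ : Measure ℝ)
    (hμ : μ = (MeasureTheory.volume.restrict (Set.Icc 0 hb)).withDensity
        (fun v => ENNReal.ofReal (f v)))
    -- the density condition `d/dv (R''(v)/f(v)) ≤ 0`
    (hdens : ∀ v ∈ Set.Icc 0 hb, deriv (fun w => deriv (deriv (revFn f)) w / f w) v ≤ 0)
    -- the tradeoff function and its curvature conditions
    (g : ℝ → ℝ → ℝ)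
    (hgsmooth : ContDiff ℝ 2 (fun q : ℝ × ℝ => g q.1 q.2))
    (hguu : ∀ v ∈ Set.Icc 0 hb, ∀ u : ℝ, deriv (deriv (g v)) u ≤ 0)
    (hgvu : ∀ v ∈ Set.Icc 0 hb, ∀ u : ℝ, deriv (fun w => deriv (g w) u) v ≤ 0) :
    sSup {s : ℝ | ∃ x p : ℝ → ℝ, Feas hb x p ∧ s = tObj μ g x p}
      = sSup {s : ℝ | ∃ x p : ℝ → ℝ, Feas hb x p ∧ IsStep hb x ∧ s = tObj μ g x p}
    ∧ ((∃ x p : ℝ → ℝ, Feas hb x p ∧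
          ∀ y q : ℝ → ℝ, Feas hb y q → tObj μ g y q ≤ tObj μ g x p) →
        ∃ x p : ℝ → ℝ, Feas hb x p ∧ IsStep hb x ∧
          ∀ y q : ℝ → ℝ, Feas hb y q → tObj μ g y q ≤ tObj μ g x p) := by
  have hhb' : 0 < hb := by
    rcases hhb.eq_or_lt with e | e
    · exfalso
      rw [← e] at hone
      simp at hone
    · exact e
  have main := fun {x p : ℝ → ℝ} (h : Feas hb x p) =>
    exists_step hhb' hsmooth hpos hμ hdens hgsmooth hguu hgvu h
  constructor
  · apply csSup_eq_csSup_of_forall_exists_le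
    · rintro s ⟨x, p, h, rfl⟩
      obtain ⟨y, q, h1, h2, h3⟩ := main h
      exact ⟨_, ⟨y, q, h1, h2, rfl⟩, h3⟩
    · rintro s ⟨x, p, h, _, rfl⟩
      exact ⟨_, ⟨x, p, h, rfl⟩, le_rfl⟩
  · rintro ⟨x, p, h, hopt⟩
    obtain ⟨y, q, h1, h2, h3⟩ := main h
    exact ⟨y, q, h1, h2, fun y' q' h' => (hopt y' q' h').trans h3⟩
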